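/- (Lemma 2(c)) There is a constant K' > 0, independent of n, z, z', such that for all n ≥ 1 and all z, z' ∈ Z, |R_n(z,z') − R_{n+1}(z,z')| ≤ K'·a_n·{ ( g₀(z') + (π(z')/π(z))·g₀(z) ) + ( 1 + g₀(z)/π(z) )·δ_z(z') }, where a_n = sup_{w∈Z} |ḡ_n(w) − ḡ_{n+1}(w)|/g₀(w). -/

import Mathlib

theorem min_one_mul_div_mul_eq_min {r x y : ℝ} (hy : 0 < y) :
    min 1 (r * (x / y)) * y = min y (r * x) := by
  rw [min_mul_of_nonneg _ _ hy.le, one_mul, mul_assoc, div_mul_cancel₀ _ hy.ne']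

theorem abs_min_sub_min_le_add (a b c d : ℝ) :
    |min a b - min c d| ≤ |a - c| + |b - d| :=
  (abs_min_sub_min_le_max a b c d).trans
    (max_le_add_of_nonneg (abs_nonneg _) (abs_nonneg _))

theorem abs_tsum_sub_tsum_le {ι : Type*} {f g b : ι → ℝ} {s : ℝ} (hf : Summable f)
    (hg : Summable g) (hb : HasSum b s) (h : ∀ i, |f i - g i| ≤ b i) :
    |∑' i, f i - ∑' i, g i| ≤ s := by
  rw [← hf.tsum_sub hg]
  exact tsum_of_norm_bounded (f := fun i => f i - g i) hb h

theorem lemma2c {Z : Type*} [Countable Z] [DecidableEq Z]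
    (π g₀ : Z → ℝ) (gbar : ℕ → Z → ℝ) (q : ℕ → Z → ℝ) (ω₁ K : ℝ)
    (hπpos : ∀ z, 0 < π z) (hπsum : HasSum π 1)
    (hg₀pos : ∀ z, 0 < g₀ z) (hg₀sum : HasSum g₀ 1)
    (hgbarpos : ∀ n, 1 ≤ n → ∀ z, 0 ≤ gbar n z)
    (hgbarsum : ∀ n, 1 ≤ n → HasSum (gbar n) 1)
    (hω₁pos : 0 < ω₁) (hω₁lt : ω₁ < 1)
    (hq : ∀ n z, q n z = ω₁ * g₀ z + (1 - ω₁) * gbar n z)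
    (hK : 1 ≤ K)
    (hdomπ : ∀ z, π z ≤ K * g₀ z)
    (hdomgbar : ∀ n, 1 ≤ n → ∀ z, gbar n z ≤ K * g₀ z)
    (α : ℕ → Z → Z → ℝ)
    (hα : ∀ n z z', α n z z' = min 1 ((π z' / π z) * (q n z / q n z')))
    (ν : ℕ → Z → ℝ)
    (hν : ∀ n z, ν n z = ∑' z', α n z z' * q n z')
    (T : ℕ → Z → Z → ℝ)
    (hT : ∀ n z z', T n z z' = α n z z' * q n z'
      + (if z' = z then (1:ℝ) else 0) * (1 - ν n z))
    (ε₁ : ℝ) (hε₁pos : 0 < ε₁) (hε₁lt : ε₁ < 1)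
    (hε₁min : ∀ n, 1 ≤ n → ∀ z z', ε₁ * π z' ≤ α n z z' * q n z')
    (ε : ℝ) (hεpos : 0 < ε) (hεlt : ε < ε₁)
    (R : ℕ → Z → Z → ℝ)
    (hR : ∀ n z z', R n z z' = (T n z z' - ε * π z') / (1 - ε))
    (a : ℕ → ℝ)
    (habdd : ∀ n, 1 ≤ n → BddAbove (Set.range fun w => |gbar n w - gbar (n+1) w| / g₀ w))
    (ha : ∀ n, 1 ≤ n → a n = ⨆ w, |gbar n w - gbar (n+1) w| / g₀ w) :
    ∃ K' : ℝ, 0 < K' ∧ ∀ n, 1 ≤ n → ∀ z z',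
      |R n z z' - R (n+1) z z'| ≤ K' * a n *
        ((g₀ z' + (π z' / π z) * g₀ z)
          + (1 + g₀ z / π z) * (if z' = z then (1:ℝ) else 0)) := by
  have hqpos : ∀ n, 1 ≤ n → ∀ z, 0 < q n z := fun n hn z => by
    rw [hq]
    exact add_pos_of_pos_of_nonneg (mul_pos hω₁pos (hg₀pos z))
      (mul_nonneg (sub_nonneg.2 hω₁lt.le) (hgbarpos n hn z))
  have hqsum : ∀ n, 1 ≤ n → Summable (q n) := fun n hn => by
    rw [funext (hq n)]
    exact (hg₀sum.summable.mul_left _).add ((hgbarsum n hn).summable.mul_left _)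
  have hαq : ∀ n, 1 ≤ n → ∀ z z', α n z z' * q n z' = min (q n z') (π z' / π z * q n z) :=
    fun n hn z z' => by rw [hα, min_one_mul_div_mul_eq_min (hqpos n hn z')]
  have hαqsum : ∀ n, 1 ≤ n → ∀ z, Summable fun z' => α n z z' * q n z' := fun n hn z =>
    (hqsum n hn).of_nonneg_of_le
      (fun z' => (mul_pos hε₁pos (hπpos z')).le.trans (hε₁min n hn z z'))
      (fun z' => (hαq n hn z z').trans_le (min_le_left _ _))
  have hqdiff : ∀ n, 1 ≤ n → ∀ z, |q n z - q (n + 1) z| ≤ a n * g₀ z := fun n hn z => by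
    have hsup : |gbar n z - gbar (n + 1) z| ≤ a n * g₀ z := by
      rw [← div_le_iff₀ (hg₀pos z), ha n hn]
      exact le_ciSup (habdd n hn) z
    have hsub : q n z - q (n + 1) z = (1 - ω₁) * (gbar n z - gbar (n + 1) z) := by
      rw [hq, hq]
      ring
    rw [hsub, abs_mul, abs_of_pos (sub_pos.2 hω₁lt)]
    exact (mul_le_of_le_one_left (abs_nonneg _) (by linarith)).trans hsup
  have hαqdiff : ∀ n, 1 ≤ n → ∀ z z', |α n z z' * q n z' - α (n + 1) z z' * q (n + 1) z'| ≤
      a n * (g₀ z' + π z' / π z * g₀ z) := fun n hn z z' => by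
    have hratio : 0 ≤ π z' / π z := (div_pos (hπpos z') (hπpos z)).le
    rw [hαq n hn, hαq (n + 1) n.succ_pos]
    refine (abs_min_sub_min_le_add _ _ _ _).trans ?_
    rw [← mul_sub, abs_mul, abs_of_nonneg hratio]
    have h := mul_le_mul_of_nonneg_left (hqdiff n hn z) hratio
    linarith [hqdiff n hn z']
  have hνdiff : ∀ n, 1 ≤ n → ∀ z, |ν n z - ν (n + 1) z| ≤ a n * (1 + g₀ z / π z) :=
    fun n hn z => by
    rw [hν, hν]
    refine abs_tsum_sub_tsum_le (hαqsum n hn z) (hαqsum (n + 1) n.succ_pos z) ?_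
      (hαqdiff n hn z)
    have h := (hg₀sum.add ((hπsum.div_const (π z)).mul_right (g₀ z))).mul_left (a n)
    rwa [one_div_mul_eq_div] at h
  have hε : 0 < 1 - ε := by linarith
  refine ⟨(1 - ε)⁻¹, inv_pos.2 hε, fun n hn z z' => ?_⟩
  have hsub : R n z z' - R (n + 1) z z' = (1 - ε)⁻¹ *
      ((α n z z' * q n z' - α (n + 1) z z' * q (n + 1) z') -
        (ν n z - ν (n + 1) z) * (if z' = z then (1 : ℝ) else 0)) := by
    rw [hR, hR, hT, hT]
    ring
  have hδ : (0 : ℝ) ≤ if z' = z then (1 : ℝ) else 0 := by split_ifs <;> norm_num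
  rw [hsub, abs_mul, abs_of_pos (inv_pos.2 hε), mul_assoc]
  refine mul_le_mul_of_nonneg_left ((abs_sub _ _).trans ?_) (inv_pos.2 hε).le
  rw [abs_mul, abs_of_nonneg hδ, mul_add, ← mul_assoc (a n) (1 + g₀ z / π z)]
  exact add_le_add (hαqdiff n hn z z') (mul_le_mul_of_nonneg_right (hνdiff n hn z) hδ)
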